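/- Assume 0 ≤ h₁ < h₂ < ⋯ < h_{n+1}, and for 1 ≤ m ≤ n define r₁₁(m) = (S₂ₘ − S₁ₘ·h_{m+1})/(S₁ₘ − m·h_{m+1}). Then 0 ≤ r₁₁(m) ≤ r₁₁(m+1) for every 1 ≤ m ≤ n−1; that is, the sequence m ↦ r₁₁(m) is non-negative and non-decreasing, with final value r₁₁(n) = (S₂ₙ − S₁ₙh_{n+1})/(S₁ₙ − n·h_{n+1}). -/

import Mathlib

open Matrix

/-- `S₁ₘ = ∑_{i=1}^m hᵢ` (paper's `hᵢ` is `h (i-1)`). -/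
noncomputable def S1 (h : ℕ → ℝ) (m : ℕ) : ℝ := ∑ i ∈ Finset.range m, h i

/-- `S₂ₘ = ∑_{i=1}^m hᵢ²`. -/
noncomputable def S2 (h : ℕ → ℝ) (m : ℕ) : ℝ := ∑ i ∈ Finset.range m, (h i) ^ 2

/-- `Vₘ = S₂ₘ/m − (S₁ₘ/m)²`. -/
noncomputable def Vm (h : ℕ → ℝ) (m : ℕ) : ℝ := S2 h m / m - (S1 h m / m) ^ 2

/-- `r₁₁(m) = (S₂ₘ − S₁ₘ h_{m+1})/(S₁ₘ − m h_{m+1})`; the paper's `h_{m+1}` is `h m`. -/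
noncomputable def r11seq (h : ℕ → ℝ) (m : ℕ) : ℝ :=
  (S2 h m - S1 h m * h m) / (S1 h m - m * h m)

lemma S1_succ (h : ℕ → ℝ) (m : ℕ) : S1 h (m + 1) = S1 h m + h m :=
  Finset.sum_range_succ _ _

lemma S2_succ (h : ℕ → ℝ) (m : ℕ) : S2 h (m + 1) = S2 h m + h m ^ 2 :=
  Finset.sum_range_succ _ _

lemma S1_sq_le (h : ℕ → ℝ) (m : ℕ) : S1 h m ^ 2 ≤ m * S2 h m := by
  simpa [S1, S2] using sq_sum_le_card_mul_sum_sq (s := Finset.range m) (f := h)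

lemma sum_sub_sq_nonneg (h : ℕ → ℝ) (m : ℕ) (x : ℝ) :
    0 ≤ S2 h m - 2 * x * S1 h m + m * x ^ 2 := by
  have key : ∑ i ∈ Finset.range m, (h i - x) ^ 2 = S2 h m - 2 * x * S1 h m + m * x ^ 2 := by
    simp only [S1, S2, sub_sq, Finset.sum_add_distrib, Finset.sum_sub_distrib, Finset.mul_sum,
      Finset.sum_const, Finset.card_range, nsmul_eq_mul]
    congr 2
    exact Finset.sum_congr rfl fun i _ => by ring
  exact key ▸ Finset.sum_nonneg fun i _ => sq_nonneg _

lemma S1_lt_mul {h : ℕ → ℝ} {m : ℕ} {x : ℝ} (hm : 1 ≤ m) (hx : ∀ i < m, h i < x) :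
    S1 h m < m * x := by
  have key : S1 h m < ∑ _i ∈ Finset.range m, x :=
    Finset.sum_lt_sum_of_nonempty (Finset.nonempty_range_iff.2 (by omega))
      fun i hi => hx i (Finset.mem_range.1 hi)
  simpa using key

lemma S2_le_S1_mul {h : ℕ → ℝ} {m : ℕ} {x : ℝ} (h0 : ∀ i < m, 0 ≤ h i)
    (hx : ∀ i < m, h i ≤ x) : S2 h m ≤ S1 h m * x := by
  rw [S1, S2, Finset.sum_mul]
  refine Finset.sum_le_sum fun i hi => ?_
  rw [Finset.mem_range] at hi
  rw [sq]
  exact mul_le_mul_of_nonneg_left (hx i hi) (h0 i hi)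

lemma r11seq_eq_neg_div_neg (h : ℕ → ℝ) (m : ℕ) :
    r11seq h m = (S1 h m * h m - S2 h m) / (m * h m - S1 h m) := by
  rw [r11seq, ← neg_div_neg_eq, neg_sub, neg_sub]

/-- Corollary A.8: for non-negative strictly increasing design
points, the sequence `m ↦ r₁₁(m)` is non-negative and non-decreasing on `1 ≤ m ≤ n`
(its final value `r₁₁(n) = (S₂ₙ − S₁ₙ h_{n+1})/(S₁ₙ − n h_{n+1})` by definition). -/
theorem r11seq_nonneg_monotone
    (n : ℕ) (hn : 2 ≤ n) (h : ℕ → ℝ)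
    (hh0 : 0 ≤ h 0) (hhinc : ∀ i, i < n → h i < h (i + 1)) :
    (∀ m : ℕ, 1 ≤ m → m ≤ n → 0 ≤ r11seq h m) ∧
    (∀ m : ℕ, 1 ≤ m → m + 1 ≤ n → r11seq h m ≤ r11seq h (m + 1)) ∧
    r11seq h n = (S2 h n - S1 h n * h n) / (S1 h n - n * h n) := by
  have mono : StrictMonoOn h (Set.Iic n) :=
    strictMonoOn_of_lt_add_one Set.ordConnected_Iic fun i _ _ hi => hhinc i hi
  have lt {i j : ℕ} (hij : i < j) (hj : j ≤ n) : h i < h j :=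
    mono (hij.le.trans hj) hj hij
  have nonneg {i : ℕ} (hi : i ≤ n) : 0 ≤ h i :=
    hh0.trans (mono.monotoneOn (Nat.zero_le n) hi (Nat.zero_le i))
  have denom {m : ℕ} (hm : 1 ≤ m) (hmn : m ≤ n) : 0 < m * h m - S1 h m :=
    sub_pos.2 (S1_lt_mul hm fun i hi => lt hi hmn)
  refine ⟨fun m hm hmn => ?_, fun m hm hmn => ?_, rfl⟩
  · rw [r11seq_eq_neg_div_neg]
    exact div_nonneg (sub_nonneg.2 (S2_le_S1_mul (fun i hi => nonneg (hi.le.trans hmn))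
      fun i hi => (lt hi hmn).le)) (denom hm hmn).le
  · have hD' := denom (Nat.le_add_left 1 m) hmn
    rw [r11seq_eq_neg_div_neg, r11seq_eq_neg_div_neg,
      div_le_div_iff₀ (denom hm (by omega)) hD', S1_succ, S2_succ]
    have ht : 0 ≤ h (m + 1) - h m := (sub_pos.2 (lt m.lt_succ_self hmn)).le
    have hdisc : 0 ≤ (m * S2 h m - S1 h m ^ 2)
        + (S2 h m - 2 * h m * S1 h m + m * h m ^ 2) :=
      add_nonneg (sub_nonneg.2 (S1_sq_le h m)) (sum_sub_sq_nonneg h m (h m))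
    push_cast
    linear_combination mul_nonneg ht hdisc
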